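/- Let ℓ ≥ 1 be an integer, n = Nℓ, and take the L-operator L(z,λ) on ℂ^N ⊗ (ℂ^N)^{⊗Nℓ} with evaluation point w = 0. For all (z, γ, λ) in a dense open subset of ℂ × ℂ × ℂ^N and every i ∈ {1,…,N}, write L(z,λ)(e_i ⊗ e) = ∑_{j=1}^N e_j ⊗ v_j. Then v_i = [θ(z−γℓ)/θ(z−γNℓ)] · ∏_{j≠i} [θ(λ_i−λ_j+ℓγ)/θ(λ_i−λ_j)] · e. Consequently, the transfer matrix of the Nℓ-th symmetric power of the vector representation, T(z)f(λ) = ∑_{i=1}^N c_i(z,λ) f(λ−γω_i) where v_i = c_i(z,λ)·e, equals [θ(z−γℓ)/θ(z−γNℓ)] times the Ruijsenaars operator M, where M f(λ) = ∑_{i=1}^N ∏_{j≠i} [θ(λ_i−λ_j+ℓγ)/θ(λ_i−λ_j)] f(λ−γω_i). -/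

import Mathlib

open scoped BigOperators
open Complex Matrix Filter Topology

noncomputable section

namespace EllipticQG

/-- Jacobi's first theta function `θ(z) = -∑_{j ∈ ℤ+1/2} e^{πij²τ + 2πij(z+1/2)}`. -/
def theta (τ z : ℂ) : ℂ :=
  -∑' j : ℤ, Complex.exp ((Real.pi : ℂ) * Complex.I * ((j : ℂ) + 1 / 2) ^ 2 * τ +
      2 * (Real.pi : ℂ) * Complex.I * ((j : ℂ) + 1 / 2) * (z + 1 / 2))

/-- `α(z,μ) = θ(z)θ(μ+γ)/(θ(z-γ)θ(μ))`. -/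
def alphaF (τ γ z μ : ℂ) : ℂ :=
  theta τ z * theta τ (μ + γ) / (theta τ (z - γ) * theta τ μ)

/-- `β(z,μ) = -θ(z+μ)θ(γ)/(θ(z-γ)θ(μ))`. -/
def betaF (τ γ z μ : ℂ) : ℂ :=
  -(theta τ (z + μ) * theta τ γ) / (theta τ (z - γ) * theta τ μ)

/-- The elliptic dynamical R-matrix of `E_{τ,γ/2}(gl_N)` on `ℂ^N ⊗ ℂ^N`.
Entry `((i,j),(k,l))` is the coefficient of `e_i ⊗ e_j` in `R (e_k ⊗ e_l)`. -/
def Rmat (N : ℕ) (τ γ z : ℂ) (lam : Fin N → ℂ) :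
    Matrix (Fin N × Fin N) (Fin N × Fin N) ℂ := fun p q =>
  if p.1 = p.2 then (if q = p then 1 else 0)
  else (if q = p then alphaF τ γ z (lam p.1 - lam p.2) else 0) +
    (if q = (p.2, p.1) then betaF τ γ z (lam p.1 - lam p.2) else 0)

/-- `λ - γ ∑_{c ∈ S} h^{(c)}` evaluated on the configuration `g` of basis indices. -/
def shiftL {n N : ℕ} (γ : ℂ) (lam : Fin N → ℂ) (S : Finset (Fin n)) (g : Fin n → Fin N) :
    Fin N → ℂ :=
  fun i => lam i - γ * ((S.filter fun c => g c = i).card : ℂ)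

/-- `R(z, λ - γ ∑_{c∈S} h^{(c)})^{(a b)}` acting on `(ℂ^N)^{⊗ n}`. -/
def Rop (N n : ℕ) (τ γ z : ℂ) (lam : Fin N → ℂ) (S : Finset (Fin n)) (a b : Fin n) :
    Matrix (Fin n → Fin N) (Fin n → Fin N) ℂ := fun f g =>
  if ∀ c, c ≠ a → c ≠ b → f c = g c then
    Rmat N τ γ z (shiftL γ lam S g) (f a, f b) (g a, g b)
  else 0

/-- The operators `W_n(z,λ)`, defined recursively:  `W_1 = 1` and
`W_{n+1}(z,λ) = R(z_1-z_2, λ-γ∑_{j=3}^{n+1}h^{(j)})^{(12)} ⋯ R(z_1-z_{n+1},λ)^{(1 n+1)}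
  (1 ⊗ W_n(z_2,…,z_{n+1}, λ-γh^{(1)}))` (tensor factors indexed `0,…,n`). -/
def Wrec (N : ℕ) (τ γ : ℂ) : (n : ℕ) → (Fin n → ℂ) → (Fin N → ℂ) →
    Matrix (Fin n → Fin N) (Fin n → Fin N) ℂ
  | 0, _, _ => 1
  | n + 1, z, lam =>
    (((List.finRange n).map fun j : Fin n =>
      Rop N (n + 1) τ γ (z 0 - z j.succ) lam
        (Finset.univ.filter fun c : Fin (n + 1) => j.succ < c) 0 j.succ).prod) *
      Matrix.of (fun f g : Fin (n + 1) → Fin N =>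
        if f 0 = g 0 then
          Wrec N τ γ n (fun j => z j.succ) (fun i => lam i - if g 0 = i then γ else 0)
            (Fin.tail f) (Fin.tail g)
        else 0)

/-- `W^S_n(λ) = W_n(z^S, λ)` with `z^S = (0, γ, 2γ, …, (n-1)γ)`. -/
def WS (N n : ℕ) (τ γ : ℂ) (lam : Fin N → ℂ) :
    Matrix (Fin n → Fin N) (Fin n → Fin N) ℂ :=
  Wrec N τ γ n (fun j => ((j : ℕ) : ℂ) * γ) lam

/-- `z^∧ = ((n-1)γ, …, 2γ, γ, 0)`. -/
def zWedge (n : ℕ) (γ : ℂ) : Fin n → ℂ := fun j => ((n - 1 - (j : ℕ) : ℕ) : ℂ) * γ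

/-- `W^∧_n(λ) = lim_{z → z^∧} ∏_{j=1}^{n-1} (z_j - z_{j+1} - γ) · ρ W_n(z,λ) ρ`,
where `ρ` reverses the order of the tensor factors. -/
def Wwedge (N n : ℕ) (τ γ : ℂ) (lam : Fin N → ℂ) :
    Matrix (Fin n → Fin N) (Fin n → Fin N) ℂ :=
  limUnder (𝓝[≠] zWedge n γ) fun z : Fin n → ℂ =>
    (∏ j : Fin n, if h : (j : ℕ) + 1 < n then z j - z ⟨(j : ℕ) + 1, h⟩ - γ else 1) •
      Matrix.of fun f g : Fin n → Fin N => Wrec N τ γ n z lam (f ∘ Fin.rev) (g ∘ Fin.rev)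

/-- The space `S²(ℂ^N)` of symmetric tensors in `ℂ^N ⊗ ℂ^N`. -/
def symPair (N : ℕ) : Submodule ℂ ((Fin N × Fin N) → ℂ) where
  carrier := {v | ∀ p : Fin N × Fin N, v p = v (p.2, p.1)}
  add_mem' := by intro a b ha hb p; simp only [Pi.add_apply, ha p, hb p]
  zero_mem' := by intro p; rfl
  smul_mem' := by intro c v hv p; simp only [Pi.smul_apply, hv p]

/-- `R^{reg}(γ,λ) = lim_{z→γ} (z-γ) R(z,λ)`. -/
def Rreg (N : ℕ) (τ γ : ℂ) (lam : Fin N → ℂ) : Matrix (Fin N × Fin N) (Fin N × Fin N) ℂ :=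
  limUnder (𝓝[≠] γ) fun z : ℂ => (z - γ) • Rmat N τ γ z lam

/-- The flip `P : u ⊗ v ↦ v ⊗ u` on `ℂ^N ⊗ ℂ^N`. -/
def Pmat (N : ℕ) : Matrix (Fin N × Fin N) (Fin N × Fin N) ℂ := fun p q =>
  if q = (p.2, p.1) then 1 else 0

/-- The space `S^n(ℂ^N)` of symmetric tensors in `(ℂ^N)^{⊗n}`. -/
def symTensors (N n : ℕ) : Submodule ℂ ((Fin n → Fin N) → ℂ) where
  carrier := {v | ∀ (σ : Equiv.Perm (Fin n)) (f : Fin n → Fin N), v (f ∘ σ) = v f}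
  add_mem' := by intro a b ha hb σ f; simp only [Pi.add_apply, ha σ f, hb σ f]
  zero_mem' := by intro σ f; rfl
  smul_mem' := by intro c v hv σ f; simp only [Pi.smul_apply, hv σ f]

/-- `J_n(ℂ^N)`: the span of tensors `σ v - sign(σ) v`. -/
def Jspan (N n : ℕ) : Submodule ℂ ((Fin n → Fin N) → ℂ) :=
  Submodule.span ℂ {w | ∃ (σ : Equiv.Perm (Fin n)) (v : (Fin n → Fin N) → ℂ),
    w = (fun f => v (f ∘ σ)) - ((Equiv.Perm.sign σ : ℤ) : ℂ) • v}

/-- `ℂ^N ⊗ W ⊆ ℂ^N ⊗ (ℂ^N)^{⊗ n}` for a subspace `W ⊆ (ℂ^N)^{⊗ n}`. -/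
def consSlice (N n : ℕ) (W : Submodule ℂ ((Fin n → Fin N) → ℂ)) :
    Submodule ℂ ((Fin (n + 1) → Fin N) → ℂ) where
  carrier := {v | ∀ i : Fin N, (fun g : Fin n → Fin N => v (Fin.cons i g)) ∈ W}
  add_mem' := by intro a b ha hb i; exact W.add_mem (ha i) (hb i)
  zero_mem' := by intro i; exact W.zero_mem
  smul_mem' := by intro c v hv i; exact W.smul_mem c (hv i)

/-- The `L`-operator of `V^{⊗n}(w)`:
`L(z,λ) = R(z-w, λ-γ∑_{j=2}^n h^{(j)})^{(01)} ⋯ R(z-w-γ(n-1), λ)^{(0n)}`,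
acting on `ℂ^N ⊗ (ℂ^N)^{⊗n}` with factors numbered `0,…,n`. -/
def Lop (N n : ℕ) (τ γ z w : ℂ) (lam : Fin N → ℂ) :
    Matrix (Fin (n + 1) → Fin N) (Fin (n + 1) → Fin N) ℂ :=
  ((List.finRange n).map fun j : Fin n =>
    Rop N (n + 1) τ γ (z - w - (j : ℕ) * γ) lam
      (Finset.univ.filter fun c : Fin (n + 1) => j.succ < c) 0 j.succ).prod

/-- The `L`-operator for the opposite coproduct:
`L'(z,λ) = R(z-w-γ(n-1), λ-γ∑_{j=1}^{n-1} h^{(j)})^{(0n)} ⋯ R(z-w, λ)^{(01)}`. -/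
def Lop' (N n : ℕ) (τ γ z w : ℂ) (lam : Fin N → ℂ) :
    Matrix (Fin (n + 1) → Fin N) (Fin (n + 1) → Fin N) ℂ :=
  (((List.finRange n).reverse).map fun j : Fin n =>
    Rop N (n + 1) τ γ (z - w - (j : ℕ) * γ) lam
      (Finset.univ.filter fun c : Fin (n + 1) => 0 < c ∧ c < j.succ) 0 j.succ).prod

/-- `Id ⊗ M` on `ℂ^N ⊗ (ℂ^N)^{⊗n}`. -/
def idTensor (N n : ℕ) (M : Matrix (Fin n → Fin N) (Fin n → Fin N) ℂ) :
    Matrix (Fin (n + 1) → Fin N) (Fin (n + 1) → Fin N) ℂ :=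
  Matrix.of fun f g => if f 0 = g 0 then M (Fin.tail f) (Fin.tail g) else 0

/-- `Id ⊗ M(λ - γ h^{(0)})` on `ℂ^N ⊗ (ℂ^N)^{⊗n}`. -/
def idTensorShift (N n : ℕ) (γ : ℂ)
    (M : (Fin N → ℂ) → Matrix (Fin n → Fin N) (Fin n → Fin N) ℂ) (lam : Fin N → ℂ) :
    Matrix (Fin (n + 1) → Fin N) (Fin (n + 1) → Fin N) ℂ :=
  Matrix.of fun f g =>
    if f 0 = g 0 then M (fun i => lam i - if g 0 = i then γ else 0) (Fin.tail f) (Fin.tail g)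
    else 0

/-- The zero-weight symmetric tensor `e`: the sum of all `e_{i_1} ⊗ ⋯ ⊗ e_{i_n}` over
sequences in which each index occurs exactly `ℓ` times. -/
def evec (N n ℓ : ℕ) : (Fin n → Fin N) → ℂ := fun f =>
  if ∀ i : Fin N, (Finset.univ.filter fun j => f j = i).card = ℓ then 1 else 0

/-- The multi-index of `ē = e_1^{⊗ℓ} ⊗ ⋯ ⊗ e_N^{⊗ℓ}`. -/
def barIdx (N ℓ : ℕ) : Fin (N * ℓ) → Fin N := fun j =>
  ⟨j.val / ℓ, by
    have h : (j : ℕ) < ℓ * N := by rw [Nat.mul_comm ℓ N]; exact j.isLt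
    exact Nat.div_lt_of_lt_mul h⟩

/-- `g_{N,ℓ}(λ) = ∏_{1≤j<k≤N} ∏_{s=1}^ℓ θ(λ_j-λ_k+γs)/θ(λ_j-λ_k-γ(s-1))`. -/
def gfun (N ℓ : ℕ) (τ γ : ℂ) (lam : Fin N → ℂ) : ℂ :=
  ∏ j : Fin N, ∏ k : Fin N,
    if j < k then
      ∏ s ∈ Finset.Icc 1 ℓ,
        theta τ (lam j - lam k + γ * (s : ℂ)) / theta τ (lam j - lam k - γ * ((s : ℂ) - 1))
    else 1

/-- The permutation induced by a word in the generators `s_1, …, s_n` of `S_{n+1}`: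
`π_k = s_{a_1} ∘ ⋯ ∘ s_{a_k}` (letters `a` act as the transposition of `a` and `a+1`). -/
def permOfWord {n : ℕ} : List (Fin n) → Equiv.Perm (Fin (n + 1))
  | [] => 1
  | a :: rest => Equiv.swap a.castSucc a.succ * permOfWord rest

/-- The product of R-matrices attached to a word (with accumulated permutation `π`):
`W_w(z,λ) = F_k ⋯ F_1` where for the `t`-th letter `a`
`F_t = R(z_{π(a)} - z_{π(a+1)}, λ - γ ∑_{b<a} h^{(π(b))})^{(π(a), π(a+1))}`,
`π = π_{t-1}` the permutation induced by the earlier letters. -/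
def Wword (N : ℕ) {n : ℕ} (τ γ : ℂ) (z : Fin (n + 1) → ℂ) (lam : Fin N → ℂ) :
    List (Fin n) → Equiv.Perm (Fin (n + 1)) →
      Matrix (Fin (n + 1) → Fin N) (Fin (n + 1) → Fin N) ℂ
  | [], _ => 1
  | a :: rest, π =>
      Wword N τ γ z lam rest (π * Equiv.swap a.castSucc a.succ) *
        Rop N (n + 1) τ γ (z (π a.castSucc) - z (π a.succ)) lam
          ((Finset.univ.filter fun c : Fin (n + 1) => (c : ℕ) < (a : ℕ)).image π)
          (π a.castSucc) (π a.succ)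

/-- The fused R-matrix `𝓡_{V^{⊗m}(z), V^{⊗n}(w)}(λ)` on `(ℂ^N)^{⊗(m+n)}`
(first block: factors `0,…,m-1`; second block: factors `m,…,m+n-1`). -/
def Rmn (N m n : ℕ) (τ γ z w : ℂ) (lam : Fin N → ℂ) :
    Matrix (Fin (m + n) → Fin N) (Fin (m + n) → Fin N) ℂ :=
  ((List.finRange m).map fun a : Fin m =>
    ((List.finRange n).map fun j : Fin n =>
      Rop N (m + n) τ γ (z + (a : ℕ) * γ - w - (j : ℕ) * γ) lam
        (Finset.univ.filter fun c : Fin (m + n) =>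
          (c : ℕ) < (a : ℕ) ∨ m + (j : ℕ) < (c : ℕ))
        (Fin.castAdd n a) (Fin.natAdd m j)).prod).prod

/-- `A ⊗ B ⊆ (ℂ^N)^{⊗m} ⊗ (ℂ^N)^{⊗n}`, realised as `(A ⊗ V₂) ∩ (V₁ ⊗ B)`. -/
def blockSub (N m n : ℕ) (A : Submodule ℂ ((Fin m → Fin N) → ℂ))
    (B : Submodule ℂ ((Fin n → Fin N) → ℂ)) :
    Submodule ℂ ((Fin (m + n) → Fin N) → ℂ) where
  carrier := {v |
    (∀ g : Fin n → Fin N, (fun f : Fin m → Fin N => v (Fin.append f g)) ∈ A) ∧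
    ∀ f : Fin m → Fin N, (fun g : Fin n → Fin N => v (Fin.append f g)) ∈ B}
  add_mem' := by
    intro x y hx hy
    exact ⟨fun g => A.add_mem (hx.1 g) (hy.1 g), fun f => B.add_mem (hx.2 f) (hy.2 f)⟩
  zero_mem' := ⟨fun _ => A.zero_mem, fun _ => B.zero_mem⟩
  smul_mem' := by
    intro c x hx
    exact ⟨fun g => A.smul_mem c (hx.1 g), fun f => B.smul_mem c (hx.2 f)⟩

/-- Matrix element `L_{jk}(z,λ)` of the `L`-operator (evaluation point `w = 0`),
as an operator on `(ℂ^N)^{⊗n}`: `L(z,λ)(e_k ⊗ v) = ∑_j e_j ⊗ L_{jk}(z,λ) v`. -/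
def LmatEl (N n : ℕ) (τ γ z : ℂ) (lam : Fin N → ℂ) (j k : Fin N)
    (v : (Fin n → Fin N) → ℂ) : (Fin n → Fin N) → ℂ := fun g =>
  (Lop N n τ γ z 0 lam).mulVec
    (fun f => (if f 0 = k then (1 : ℂ) else 0) * v (Fin.tail f)) (Fin.cons j g)

/-- `L_{j_{σ(1)} j_1}(z, λ-γ(ω_{j_2}+⋯+ω_{j_m})) ∘ ⋯ ∘ L_{j_{σ(m)} j_m}(z-(m-1)γ, λ)`. -/
def chainT (N n m : ℕ) (τ γ z : ℂ) (lam : Fin N → ℂ) (jt : Fin m → Fin N)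
    (σ : Equiv.Perm (Fin m)) (v : (Fin n → Fin N) → ℂ) : (Fin n → Fin N) → ℂ :=
  (List.finRange m).foldr
    (fun (t : Fin m) acc =>
      LmatEl N n τ γ (z - (t.val : ℂ) * γ)
        (fun i => lam i -
          γ * ((Finset.univ.filter fun s : Fin m => t < s ∧ jt s = i).card : ℂ))
        (jt (σ t)) (jt t) acc)
    v

/-- The transfer matrix `T_m(z)`, acting on scalar functions of `λ` via the identification
of the zero weight space of `S^{Nℓ}(ℂ^N)` with `ℂ` by the basis vector `e`:
`T_m(z) f(λ) = ∑_{j_1<⋯<j_m} ∑_{σ} (-1)^σ [L_{j_{σ(1)} j_1}(z,λ-γ(ω_{j_2}+⋯+ω_{j_m})) ⋯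
L_{j_{σ(m)} j_m}(z-(m-1)γ, λ)] e · f(λ-γ(ω_{j_1}+⋯+ω_{j_m}))`. -/
def Tm (N ℓ m : ℕ) (τ γ z : ℂ) (lam : Fin N → ℂ) (f : (Fin N → ℂ) → ℂ) : ℂ :=
  ∑ jt ∈ Finset.univ.filter fun jt : Fin m → Fin N => ∀ s t : Fin m, s < t → jt s < jt t,
    ∑ σ : Equiv.Perm (Fin m),
      ((Equiv.Perm.sign σ : ℤ) : ℂ) *
        chainT N (N * ℓ) m τ γ z lam jt σ (evec N (N * ℓ) ℓ) (barIdx N ℓ) *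
        f fun i => lam i - if ∃ t, jt t = i then γ else 0

/-- The `m`-th Ruijsenaars operator with coupling constant `ℓ`:
`M_m f(λ) = ∑_{|J|=m} ∏_{j∈J,k∉J} θ(λ_j-λ_k+ℓγ)/θ(λ_j-λ_k) · f(λ-γ∑_{j∈J}ω_j)`. -/
def Mm (N ℓ m : ℕ) (τ γ : ℂ) (f : (Fin N → ℂ) → ℂ) (lam : Fin N → ℂ) : ℂ :=
  ∑ J ∈ Finset.powersetCard m (Finset.univ : Finset (Fin N)),
    (∏ j ∈ J, ∏ k ∈ Jᶜ, theta τ (lam j - lam k + (ℓ : ℂ) * γ) / theta τ (lam j - lam k)) *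
      f fun i => lam i - if i ∈ J then γ else 0

/-- The transfer matrix with auxiliary space indexed by `ι` (weights `wt`) and quantum
space indexed by `ι₃`: `T f(λ) = ∑_μ tr_{W[μ]}(𝓡(λ)) f(λ-γμ)`. -/
def transferOp {N : ℕ} {ι ι₃ : Type} [Fintype ι] [Fintype ι₃] (γ : ℂ)
    (wt : ι → Fin N → ℂ) (R : (Fin N → ℂ) → Matrix (ι × ι₃) (ι × ι₃) ℂ)
    (f : (Fin N → ℂ) → ι₃ → ℂ) : (Fin N → ℂ) → ι₃ → ℂ := fun lam b =>
  ∑ a : ι, ∑ b' : ι₃, R lam (a, b) (a, b') * f (fun r => lam r - γ * wt a r) b'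

theorem theta_eq_jacobiTheta₂ (τ z : ℂ) :
    theta τ z = -(cexp (Real.pi * I * τ / 4 + Real.pi * I * (z + 1 / 2)) *
      jacobiTheta₂ (z + 1 / 2 + τ / 2) τ) := by
  rw [theta, jacobiTheta₂, ← tsum_mul_left]
  congr 2 with j
  rw [jacobiTheta₂_term, ← Complex.exp_add]
  ring_nf

theorem theta_neg (τ z : ℂ) : theta τ (-z) = -theta τ z := by
  rw [theta, theta, ← (Equiv.subLeft (-1 : ℤ)).tsum_eq]
  refine congrArg Neg.neg ?_
  rw [← tsum_neg]
  congr 1 with j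
  have h : cexp (Real.pi * I * (2 * j + 1)) = -1 := by
    rw [show (Real.pi * I * (2 * j + 1) : ℂ) = Real.pi * I + j * (2 * Real.pi * I) by ring,
      Complex.exp_add, Complex.exp_int_mul_two_pi_mul_I, Complex.exp_pi_mul_I, mul_one]
  rw [neg_eq_neg_one_mul (cexp _), ← h, ← Complex.exp_add,
    Complex.exp_eq_exp_iff_exists_int]
  refine ⟨-(2 * j + 1), ?_⟩
  simp only [Equiv.subLeft_apply]
  push_cast
  ring

theorem theta_zero (τ : ℂ) : theta τ 0 = 0 := by
  have h := theta_neg τ 0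
  rw [neg_zero] at h
  exact self_eq_neg.mp h

theorem differentiable_theta {τ : ℂ} (hτ : 0 < τ.im) : Differentiable ℂ (theta τ) := by
  have h : theta τ = fun z => -(cexp (Real.pi * I * τ / 4 + Real.pi * I * (z + 1 / 2)) *
      jacobiTheta₂ (z + 1 / 2 + τ / 2) τ) := funext (theta_eq_jacobiTheta₂ τ)
  rw [h]
  intro z
  refine (DifferentiableAt.mul (by fun_prop) ?_).neg
  exact DifferentiableAt.comp (g := fun w => jacobiTheta₂ w τ) (f := fun w => w + 1 / 2 + τ / 2) z
    (differentiableAt_jacobiTheta₂_fst _ hτ) (by fun_prop)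

/-- The zeroth Fourier coefficient of the theta function is `1`. -/
theorem integral_jacobiTheta₂ {τ : ℂ} (hτ : 0 < τ.im) :
    ∫ t in (0 : ℝ)..1, jacobiTheta₂ t τ = 1 := by
  have hnorm (n : ℤ) (t : ℝ) : ‖jacobiTheta₂_term n t τ‖ = ‖jacobiTheta₂_term n 0 τ‖ := by
    simp [norm_jacobiTheta₂_term]
  have hsum : Summable fun n : ℤ => ‖jacobiTheta₂_term n 0 τ‖ :=
    ((summable_jacobiTheta₂_term_iff 0 τ).2 hτ).norm
  have key := intervalIntegral.hasSum_integral_of_dominated_convergence (a := 0) (b := 1)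
    (μ := MeasureTheory.volume) (F := fun (n : ℤ) (t : ℝ) => jacobiTheta₂_term n t τ)
    (f := fun t : ℝ => jacobiTheta₂ t τ) (fun n _ => ‖jacobiTheta₂_term n 0 τ‖)
    (fun n => by
      unfold jacobiTheta₂_term
      exact Continuous.aestronglyMeasurable (by fun_prop))
    (fun n => .of_forall fun t _ => (hnorm n t).le)
    (.of_forall fun _ _ => hsum)
    (by simp)
    (.of_forall fun t _ => hasSum_jacobiTheta₂_term t hτ)
  have hterm (n : ℤ) : ∫ t in (0 : ℝ)..1, jacobiTheta₂_term n t τ = if n = 0 then 1 else 0 := by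
    split_ifs with hn
    · simp [hn, jacobiTheta₂_term]
    · have hc : (2 * Real.pi * I * n : ℂ) ≠ 0 := by
        simp [Real.pi_ne_zero, hn]
      simp_rw [jacobiTheta₂_term, Complex.exp_add]
      rw [intervalIntegral.integral_mul_const, integral_exp_mul_complex hc]
      rw [show (2 * Real.pi * I * n * (1 : ℝ) : ℂ) = n * (2 * Real.pi * I) by push_cast; ring,
        Complex.exp_int_mul_two_pi_mul_I]
      simp
  simp_rw [hterm] at key
  exact key.unique (hasSum_ite_eq 0 1)

theorem exists_theta_ne_zero {τ : ℂ} (hτ : 0 < τ.im) : ∃ z, theta τ z ≠ 0 := by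
  by_contra! h
  have h0 (z : ℂ) : jacobiTheta₂ z τ = 0 := by
    have := h (z - 1 / 2 - τ / 2)
    rw [theta_eq_jacobiTheta₂, neg_eq_zero, mul_eq_zero] at this
    simpa only [sub_add_cancel, sub_right_comm z] using this.resolve_left (Complex.exp_ne_zero _)
  simpa [h0] using integral_jacobiTheta₂ hτ

theorem dense_theta_ne_zero {τ : ℂ} (hτ : 0 < τ.im) : Dense {z | theta τ z ≠ 0} := by
  rw [← Set.compl_ofPred, ← interior_eq_empty_iff_dense_compl, Set.eq_empty_iff_forall_notMem]
  intro z₀ hz₀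
  obtain ⟨z, hz⟩ := exists_theta_ne_zero hτ
  have han : AnalyticOnNhd ℂ (theta τ) Set.univ :=
    (differentiable_theta hτ).differentiableOn.analyticOnNhd isOpen_univ
  exact hz (han.eqOn_zero_of_preconnected_of_eventuallyEq_zero isPreconnected_univ
    (Set.mem_univ z₀) (mem_interior_iff_mem_nhds.mp hz₀) (Set.mem_univ z))

/-- Pairs of integers split according to the parity of their sum. -/
def paritySplit : (ℤ × ℤ) ⊕ (ℤ × ℤ) ≃ ℤ × ℤ where
  toFun := Sum.elim (fun p => (p.1 + p.2, p.1 - p.2 - 1)) (fun p => (p.1 + p.2, p.1 - p.2))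
  invFun p := if Even (p.1 + p.2) then .inr ((p.1 + p.2) / 2, (p.1 - p.2) / 2)
    else .inl ((p.1 + p.2 + 1) / 2, (p.1 - p.2 - 1) / 2)
  left_inv := by
    rintro (⟨a, b⟩ | ⟨a, b⟩)
    · have h : ¬Even (a + b + (a - b - 1)) := by rw [Int.even_iff]; omega
      dsimp only [Sum.elim_inl]
      rw [if_neg h]
      refine congrArg Sum.inl (Prod.ext ?_ ?_) <;> dsimp only <;> omega
    · have h : Even (a + b + (a - b)) := by rw [Int.even_iff]; omega
      dsimp only [Sum.elim_inr]
      rw [if_pos h]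
      refine congrArg Sum.inr (Prod.ext ?_ ?_) <;> dsimp only <;> omega
  right_inv := by
    rintro ⟨m, n⟩
    by_cases h : Even (m + n)
    · simp only [if_pos h, Sum.elim_inr, Prod.mk.injEq]
      rw [Int.even_iff] at h
      omega
    · simp only [if_neg h, Sum.elim_inl, Prod.mk.injEq]
      rw [Int.even_iff] at h
      omega

/-- The part of the theta function of doubled period over even frequencies. -/
def thetaEven (τ x : ℂ) : ℂ :=
  ∑' a : ℤ, cexp (2 * Real.pi * I * (a : ℂ) ^ 2 * τ + 4 * Real.pi * I * a * x)

/-- The part of the theta function of doubled period over odd frequencies. -/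
def thetaOdd (τ x : ℂ) : ℂ :=
  ∑' a : ℤ, cexp (2 * Real.pi * I * ((a : ℂ) + 1 / 2) ^ 2 * τ +
    4 * Real.pi * I * (a + 1 / 2) * x)

theorem summable_thetaEven {τ : ℂ} (hτ : 0 < τ.im) (x : ℂ) : Summable fun a : ℤ =>
    cexp (2 * Real.pi * I * (a : ℂ) ^ 2 * τ + 4 * Real.pi * I * a * x) := by
  have h := (summable_jacobiTheta₂_term_iff (2 * x) (2 * τ)).2 (by simpa using hτ)
  refine h.congr fun a => ?_
  rw [jacobiTheta₂_term]
  ring_nf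

theorem summable_thetaOdd {τ : ℂ} (hτ : 0 < τ.im) (x : ℂ) : Summable fun a : ℤ =>
    cexp (2 * Real.pi * I * ((a : ℂ) + 1 / 2) ^ 2 * τ + 4 * Real.pi * I * (a + 1 / 2) * x) := by
  have h := ((summable_jacobiTheta₂_term_iff (2 * x + τ) (2 * τ)).2 (by simpa using hτ)).mul_left
    (cexp (Real.pi * I * τ / 2 + 2 * Real.pi * I * x))
  refine h.congr fun a => ?_
  rw [jacobiTheta₂_term, ← Complex.exp_add]
  ring_nf

theorem summable_theta {τ : ℂ} (hτ : 0 < τ.im) (z : ℂ) : Summable fun j : ℤ =>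
    cexp (Real.pi * I * ((j : ℂ) + 1 / 2) ^ 2 * τ +
      2 * Real.pi * I * ((j : ℂ) + 1 / 2) * (z + 1 / 2)) := by
  have h := ((summable_jacobiTheta₂_term_iff (z + 1 / 2 + τ / 2) τ).2 hτ).mul_left
    (cexp (Real.pi * I * τ / 4 + Real.pi * I * (z + 1 / 2)))
  refine h.congr fun a => ?_
  rw [jacobiTheta₂_term, ← Complex.exp_add]
  ring_nf

theorem theta_add_mul_theta_sub {τ : ℂ} (hτ : 0 < τ.im) (x y : ℂ) :
    theta τ (x + y) * theta τ (x - y) =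
      thetaEven τ x * thetaOdd τ y - thetaOdd τ x * thetaEven τ y := by
  have hE := fun x => (summable_thetaEven hτ x).norm
  have hO := fun x => (summable_thetaOdd hτ x).norm
  have hT := fun x => (summable_theta hτ x).norm
  have hs := summable_mul_of_summable_norm (hT (x + y)) (hT (x - y))
  have hs' := paritySplit.summable_iff.2 hs
  rw [theta, theta, neg_mul_neg, tsum_mul_tsum_of_summable_norm (hT (x + y)) (hT (x - y)),
    ← paritySplit.tsum_eq]
  refine (Summable.tsum_sum (hs'.comp_injective Sum.inl_injective)
    (hs'.comp_injective Sum.inr_injective)).trans ?_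
  rw [sub_eq_add_neg (thetaEven τ x * thetaOdd τ y)]
  refine congrArg₂ (· + ·) ?_ ?_
  · rw [thetaEven, thetaOdd, tsum_mul_tsum_of_summable_norm (hE x) (hO y)]
    refine tsum_congr fun ⟨a, b⟩ => ?_
    simp only [Function.comp_apply, paritySplit, Equiv.coe_fn_mk, Sum.elim_inl]
    rw [← Complex.exp_add, ← Complex.exp_add, Complex.exp_eq_exp_iff_exists_int]
    refine ⟨a, ?_⟩
    push_cast
    ring
  · rw [thetaEven, thetaOdd, tsum_mul_tsum_of_summable_norm (hO x) (hE y), ← tsum_neg]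
    refine tsum_congr fun ⟨a, b⟩ => ?_
    simp only [Function.comp_apply, paritySplit, Equiv.coe_fn_mk, Sum.elim_inr]
    rw [← mul_neg_one, ← Complex.exp_pi_mul_I, ← Complex.exp_add, ← Complex.exp_add,
      ← Complex.exp_add, Complex.exp_eq_exp_iff_exists_int]
    refine ⟨a, ?_⟩
    push_cast
    ring

/-- Weierstrass' three-term identity. -/
theorem theta_three_term {τ : ℂ} (hτ : 0 < τ.im) (x y u v : ℂ) :
    theta τ (x + y) * theta τ (x - y) * (theta τ (u + v) * theta τ (u - v)) =
      theta τ (x + u) * theta τ (x - u) * (theta τ (y + v) * theta τ (y - v)) +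
      theta τ (x + v) * theta τ (x - v) * (theta τ (u + y) * theta τ (u - y)) := by
  simp only [theta_add_mul_theta_sub hτ]
  ring

theorem theta_exchange {τ : ℂ} (hτ : 0 < τ.im) (γ z s t : ℂ) (hz : theta τ (z - γ) ≠ 0)
    (hts : theta τ (t - s) ≠ 0) :
    theta τ (z + γ - s) * theta τ t =
      alphaF τ γ z (t - s) * (theta τ (z - s) * theta τ (t - γ)) +
        betaF τ γ z (t - s) * (theta τ (z - t) * theta τ (s - γ)) := by
  have h := theta_three_term hτ (z - s / 2) (γ - s / 2) (t - s / 2) (s / 2)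
  have hodd : theta τ (γ - s) = -theta τ (s - γ) := by rw [← theta_neg, neg_sub]
  rw [show z - s / 2 + (γ - s / 2) = z + γ - s by ring,
    show z - s / 2 - (γ - s / 2) = z - γ by ring, show t - s / 2 + s / 2 = t by ring,
    show t - s / 2 - s / 2 = t - s by ring, show z - s / 2 + (t - s / 2) = z + (t - s) by ring,
    show z - s / 2 - (t - s / 2) = z - t by ring, show γ - s / 2 + s / 2 = γ by ring,
    show γ - s / 2 - s / 2 = γ - s by ring, show z - s / 2 + s / 2 = z by ring,
    show z - s / 2 - s / 2 = z - s by ring, show t - s / 2 + (γ - s / 2) = t - s + γ by ring,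
    show t - s / 2 - (γ - s / 2) = t - γ by ring, hodd] at h
  rw [alphaF, betaF]
  field_simp
  linear_combination h

/-- Up to a factor not depending on `j`, the coefficient of `e_j` in the auxiliary space after
the symmetric tensors of weight encoded by `y` have been acted upon. -/
def thetaState {N : ℕ} (τ z : ℂ) (y : Fin N → ℂ) (j : Fin N) : ℂ :=
  theta τ (z - y j) * ∏ a ∈ Finset.univ.erase j, theta τ (y a)

theorem thetaState_update_self {N : ℕ} (τ γ z : ℂ) (y : Fin N → ℂ) (j : Fin N) :
    thetaState τ z (Function.update y j (y j - γ)) j = thetaState τ (z + γ) y j := by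
  rw [thetaState, thetaState, Function.update_self]
  congr 1
  · ring_nf
  · refine Finset.prod_congr rfl fun a ha => ?_
    rw [Function.update_of_ne (Finset.ne_of_mem_erase ha)]

theorem thetaState_eq_of_ne {N : ℕ} (τ z : ℂ) (y : Fin N → ℂ) {j b : Fin N} (hb : b ≠ j) :
    thetaState τ z y j = theta τ (z - y j) * theta τ (y b) *
      ∏ a ∈ (Finset.univ.erase j).erase b, theta τ (y a) := by
  rw [thetaState, ← Finset.mul_prod_erase _ _ (Finset.mem_erase.2 ⟨hb, Finset.mem_univ b⟩),
    mul_assoc]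

theorem thetaState_exchange {N : ℕ} {τ : ℂ} (hτ : 0 < τ.im) (γ z : ℂ) (y : Fin N → ℂ)
    {j b : Fin N} (hb : b ≠ j) (hz : theta τ (z - γ) ≠ 0) (hy : theta τ (y b - y j) ≠ 0) :
    alphaF τ γ z (y b - y j) * thetaState τ z (Function.update y b (y b - γ)) j +
      betaF τ γ z (y b - y j) * thetaState τ z (Function.update y j (y j - γ)) b =
      thetaState τ (z + γ) y j := by
  have hp (c : Fin N) (hc : c = b ∨ c = j) (w : ℂ) :
      ∏ a ∈ (Finset.univ.erase j).erase b, theta τ (Function.update y c w a) =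
        ∏ a ∈ (Finset.univ.erase j).erase b, theta τ (y a) := by
    refine Finset.prod_congr rfl fun a ha => ?_
    simp only [Finset.mem_erase] at ha
    rw [Function.update_of_ne]
    rcases hc with rfl | rfl
    exacts [ha.1, ha.2.1]
  rw [thetaState_eq_of_ne τ z _ hb, thetaState_eq_of_ne τ (z + γ) _ hb,
    thetaState_eq_of_ne τ z _ hb.symm, Finset.erase_right_comm (a := b) (b := j),
    hp b (.inl rfl), hp j (.inr rfl), theta_exchange hτ γ z _ _ hz hy]
  simp only [Function.update_self, Function.update_of_ne hb, Function.update_of_ne hb.symm]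
  ring

theorem Rop_mulVec (N n : ℕ) (τ γ z : ℂ) (lam : Fin N → ℂ) (S : Finset (Fin n)) {a b : Fin n}
    (hab : a ≠ b) (ha : a ∉ S) (hb : b ∉ S) (v : (Fin n → Fin N) → ℂ) (f : Fin n → Fin N) :
    (Rop N n τ γ z lam S a b).mulVec v f =
      if f a = f b then v f
      else alphaF τ γ z (shiftL γ lam S f (f a) - shiftL γ lam S f (f b)) * v f +
        betaF τ γ z (shiftL γ lam S f (f a) - shiftL γ lam S f (f b)) *
          v (f ∘ Equiv.swap a b) := by
  have hshift (g : Fin n → Fin N) (hg : ∀ c, c ≠ a → c ≠ b → f c = g c) :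
      shiftL γ lam S g = shiftL γ lam S f := by
    funext i
    rw [shiftL, shiftL]
    congr 4
    refine Finset.filter_congr fun c hc => ?_
    rw [hg c (ne_of_mem_of_not_mem hc ha) (ne_of_mem_of_not_mem hc hb)]
  have hid (g : Fin n → Fin N) :
      (∀ c, c ≠ a → c ≠ b → f c = g c) ∧ (g a, g b) = (f a, f b) ↔ g = f := by
    constructor
    · rintro ⟨h, hp⟩
      funext c
      rcases eq_or_ne c a with rfl | hca
      · exact congrArg Prod.fst hp
      rcases eq_or_ne c b with rfl | hcb
      · exact congrArg Prod.snd hp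
      exact (h c hca hcb).symm
    · rintro rfl
      exact ⟨fun _ _ _ => rfl, rfl⟩
  have hswap (g : Fin n → Fin N) :
      (∀ c, c ≠ a → c ≠ b → f c = g c) ∧ (g a, g b) = (f b, f a) ↔ g = f ∘ Equiv.swap a b := by
    constructor
    · rintro ⟨h, hp⟩
      funext c
      rcases eq_or_ne c a with rfl | hca
      · simpa using congrArg Prod.fst hp
      rcases eq_or_ne c b with rfl | hcb
      · simpa using congrArg Prod.snd hp
      simp [Equiv.swap_apply_of_ne_of_ne hca hcb, h c hca hcb]
    · rintro rfl
      refine ⟨fun c hca hcb => ?_, by simp⟩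
      simp [Equiv.swap_apply_of_ne_of_ne hca hcb]
  have hentry (g : Fin n → Fin N) : Rop N n τ γ z lam S a b f g =
      if f a = f b then (if g = f then 1 else 0)
      else (if g = f then alphaF τ γ z (shiftL γ lam S f (f a) - shiftL γ lam S f (f b)) else 0) +
        (if g = f ∘ Equiv.swap a b then
          betaF τ γ z (shiftL γ lam S f (f a) - shiftL γ lam S f (f b)) else 0) := by
    simp only [← hid g, ← hswap g, Rop]
    by_cases hg : ∀ c, c ≠ a → c ≠ b → f c = g c
    · simp only [if_pos hg, hshift g hg, Rmat, and_iff_right hg]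
    · simp [hg]
  simp only [Matrix.mulVec, dotProduct, hentry]
  split_ifs <;> simp [add_mul, Finset.sum_add_distrib]

/-- The multiplicity of `a` among the entries of `f` at positions greater than `k`. -/
def tailCount {N n : ℕ} (f : Fin (n + 1) → Fin N) (k : ℕ) (a : Fin N) : ℕ :=
  (Finset.univ.filter fun c : Fin (n + 1) => k < (c : ℕ) ∧ f c = a).card

theorem shiftL_eq_tailCount {N n : ℕ} (γ : ℂ) (lam : Fin N → ℂ) (f : Fin (n + 1) → Fin N)
    (j : Fin n) (a : Fin N) :
    shiftL γ lam (Finset.univ.filter fun c : Fin (n + 1) => j.succ < c) f a =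
      lam a - γ * tailCount f (j + 1) a := by
  rw [shiftL, tailCount, Finset.filter_filter]
  simp only [Fin.lt_def, Fin.val_succ]

theorem tailCount_eq_add {N n : ℕ} (f : Fin (n + 1) → Fin N) (c : Fin (n + 1)) (k : ℕ)
    (hk : (c : ℕ) = k + 1) (a : Fin N) :
    tailCount f k a = tailCount f (k + 1) a + if f c = a then 1 else 0 := by
  have h : (Finset.univ.filter fun d : Fin (n + 1) => k < (d : ℕ) ∧ f d = a) =
      (Finset.univ.filter fun d : Fin (n + 1) => k + 1 < (d : ℕ) ∧ f d = a) ∪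
        if f c = a then {c} else ∅ := by
    ext d
    have hd : d = c ↔ (d : ℕ) = k + 1 := by rw [Fin.ext_iff, hk]
    by_cases hdc : d = c
    · subst hdc
      split_ifs with hc <;> simp [hc, hk]
    · have : (d : ℕ) ≠ k + 1 := fun h => hdc (hd.2 h)
      have h1 : k < (d : ℕ) ↔ k + 1 < (d : ℕ) := by omega
      split_ifs <;> simp [hdc, h1]
  rw [tailCount, tailCount, h, Finset.card_union_of_disjoint]
  · split_ifs <;> simp
  · split_ifs <;> simp [hk]

theorem tailCount_swap {N n : ℕ} (f : Fin (n + 1) → Fin N) (j : Fin n) (a : Fin N) :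
    tailCount (f ∘ Equiv.swap 0 j.succ) (j + 1) a = tailCount f (j + 1) a := by
  rw [tailCount, tailCount]
  congr 1
  refine Finset.filter_congr fun c _ => and_congr_right fun hc => ?_
  have h0 : c ≠ 0 := by rintro rfl; simp at hc
  have hj : c ≠ j.succ := by rintro rfl; simp at hc
  rw [Function.comp_apply, Equiv.swap_apply_of_ne_of_ne h0 hj]

theorem tailCount_last {N n : ℕ} (f : Fin (n + 1) → Fin N) (a : Fin N) : tailCount f n a = 0 := by
  rw [tailCount, Finset.card_eq_zero, Finset.filter_eq_empty_iff]
  rintro c - ⟨hc, -⟩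
  omega

theorem tailCount_le {N n : ℕ} (f : Fin (n + 1) → Fin N) (k : ℕ) (a : Fin N) :
    tailCount f k a ≤ n + 1 := by
  simpa [tailCount] using Finset.card_filter_le (Finset.univ : Finset (Fin (n + 1)))
    (fun c => k < (c : ℕ) ∧ f c = a)

theorem tailCount_zero {N n : ℕ} (f : Fin (n + 1) → Fin N) (a : Fin N) :
    tailCount f 0 a = (Finset.univ.filter fun c => Fin.tail f c = a).card := by
  rw [tailCount, Fin.card_filter_univ_succ]
  simp [Fin.tail]
  rfl

/-- The theta-function argument attached to `a` in the partially processed configuration `f`,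
where only factor `0` and the factors beyond `k` take part. -/
def auxCoord {N n : ℕ} (γ : ℂ) (lam : Fin N → ℂ) (i : Fin N) (f : Fin (n + 1) → Fin N) (k : ℕ)
    (a : Fin N) : ℂ :=
  lam i - lam a + γ * (((if f 0 = a then 1 else 0) + tailCount f k a : ℕ) : ℂ)

theorem auxCoord_succ {N n : ℕ} (γ : ℂ) (lam : Fin N → ℂ) (i : Fin N) (f : Fin (n + 1) → Fin N)
    (j : Fin n) :
    auxCoord γ lam i f (j + 1) = Function.update (auxCoord γ lam i f j) (f j.succ)
      (auxCoord γ lam i f j (f j.succ) - γ) := by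
  funext a
  rw [Function.update_apply]
  simp only [auxCoord, tailCount_eq_add f j.succ j (Fin.val_succ j)]
  split_ifs with h <;> simp_all <;> ring

theorem auxCoord_swap {N n : ℕ} (γ : ℂ) (lam : Fin N → ℂ) (i : Fin N) (f : Fin (n + 1) → Fin N)
    (j : Fin n) :
    auxCoord γ lam i (f ∘ Equiv.swap 0 j.succ) (j + 1) =
      Function.update (auxCoord γ lam i f j) (f 0) (auxCoord γ lam i f j (f 0) - γ) := by
  funext a
  rw [Function.update_apply]
  simp only [auxCoord, tailCount_swap, tailCount_eq_add f j.succ j (Fin.val_succ j),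
    Function.comp_apply, Equiv.swap_apply_left]
  by_cases h : f 0 = a
  · subst h
    simp
    ring
  · rw [if_neg h, if_neg (Ne.symm h)]
    push_cast
    ring

/-- The state reached from `e_i ⊗ e` after the factors beyond `k` have been acted upon, for a
weight function `W`, up to normalization. -/
def partialState {N n : ℕ} (τ γ z : ℂ) (lam : Fin N → ℂ) (i : Fin N)
    (W : (Fin (n + 1) → Fin N) → ℂ) (k : ℕ) (f : Fin (n + 1) → Fin N) : ℂ :=
  W f * thetaState τ (z - k * γ + γ) (auxCoord γ lam i f k) (f 0)

theorem Rop_mulVec_partialState {N n : ℕ} {τ : ℂ} (hτ : 0 < τ.im) (γ z : ℂ) (lam : Fin N → ℂ)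
    (i : Fin N) (W : (Fin (n + 1) → Fin N) → ℂ) (hW : ∀ f (σ : Equiv.Perm _), W (f ∘ σ) = W f)
    (hz : ∀ k ≤ n, theta τ (z - k * γ) ≠ 0)
    (hlam : ∀ a b, a ≠ b → ∀ p : ℤ, |p| ≤ n + 2 → theta τ (lam a - lam b + p * γ) ≠ 0)
    (j : Fin n) :
    (Rop N (n + 1) τ γ (z - 0 - (j : ℕ) * γ) lam
      (Finset.univ.filter fun c : Fin (n + 1) => j.succ < c) 0 j.succ).mulVec
        (partialState τ γ z lam i W (j + 1)) = partialState τ γ z lam i W j := by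
  funext f
  have hw : z - ((j : ℕ) + 1 : ℕ) * γ + γ = z - 0 - (j : ℕ) * γ := by push_cast; ring
  rw [Rop_mulVec _ _ _ _ _ _ _ (Fin.succ_ne_zero j).symm (by simp) (by simp)]
  simp only [partialState, hW, hw, auxCoord_swap, Function.comp_apply, Equiv.swap_apply_left]
  simp only [auxCoord_succ, sub_zero]
  split_ifs with h
  · rw [← h, thetaState_update_self]
  · have hy : auxCoord γ lam i f j (f j.succ) - auxCoord γ lam i f j (f 0) =
        shiftL γ lam (Finset.univ.filter fun c : Fin (n + 1) => j.succ < c) f (f 0) -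
          shiftL γ lam (Finset.univ.filter fun c : Fin (n + 1) => j.succ < c) f (f j.succ) := by
      rw [shiftL_eq_tailCount, shiftL_eq_tailCount, auxCoord, auxCoord,
        tailCount_eq_add f j.succ j (Fin.val_succ j), tailCount_eq_add f j.succ j (Fin.val_succ j)]
      simp only [if_neg h, if_neg (Ne.symm h), if_true]
      push_cast
      ring
    have hz' : theta τ (z - (j : ℕ) * γ - γ) ≠ 0 := by
      have := hz (j + 1) j.isLt
      rwa [show z - ((j : ℕ) + 1 : ℕ) * γ = z - (j : ℕ) * γ - γ by push_cast; ring] at this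
    have hy' : theta τ (auxCoord γ lam i f j (f j.succ) - auxCoord γ lam i f j (f 0)) ≠ 0 := by
      rw [hy, shiftL_eq_tailCount, shiftL_eq_tailCount]
      have h1 := tailCount_le f (j + 1) (f 0)
      have h2 := tailCount_le f (j + 1) (f j.succ)
      have := hlam (f 0) (f j.succ) h
        (tailCount f (j + 1) (f j.succ) - tailCount f (j + 1) (f 0)) (by rw [abs_le]; omega)
      convert this using 2
      push_cast
      ring
    rw [← hy, ← thetaState_exchange hτ γ _ _ (Ne.symm h) hz' hy']
    ring

theorem Lop_mulVec_partialState {N n : ℕ} {τ : ℂ} (hτ : 0 < τ.im) (γ z : ℂ) (lam : Fin N → ℂ)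
    (i : Fin N) (W : (Fin (n + 1) → Fin N) → ℂ) (hW : ∀ f (σ : Equiv.Perm _), W (f ∘ σ) = W f)
    (hz : ∀ k ≤ n, theta τ (z - k * γ) ≠ 0)
    (hlam : ∀ a b, a ≠ b → ∀ p : ℤ, |p| ≤ n + 2 → theta τ (lam a - lam b + p * γ) ≠ 0) :
    (Lop N n τ γ z 0 lam).mulVec (partialState τ γ z lam i W n) =
      partialState τ γ z lam i W 0 := by
  suffices h : ∀ k ≤ n, ((((List.finRange n).drop k).map fun j : Fin n =>
      Rop N (n + 1) τ γ (z - 0 - (j : ℕ) * γ) lam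
        (Finset.univ.filter fun c : Fin (n + 1) => j.succ < c) 0 j.succ).prod).mulVec
          (partialState τ γ z lam i W n) = partialState τ γ z lam i W k by
    simpa [Lop] using h 0 n.zero_le
  intro k hk
  induction hk using Nat.decreasingInduction with
  | self => rw [List.drop_eq_nil_of_le (by simp), List.map_nil, List.prod_nil, Matrix.one_mulVec]
  | of_succ k hk ih =>
    rw [List.drop_eq_getElem_cons (by simpa using hk), List.map_cons, List.prod_cons,
      ← Matrix.mulVec_mulVec, ih]
    simpa using Rop_mulVec_partialState hτ γ z lam i W hW hz hlam ⟨k, hk⟩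

theorem partialState_last {N n : ℕ} (τ γ z : ℂ) (lam : Fin N → ℂ) (i : Fin N)
    (W : (Fin (n + 1) → Fin N) → ℂ) (f : Fin (n + 1) → Fin N) :
    partialState τ γ z lam i W n f =
      (theta τ (z - n * γ) * ∏ a ∈ Finset.univ.erase i, theta τ (lam i - lam a)) *
        if f 0 = i then W f else 0 := by
  rw [partialState, thetaState]
  split_ifs with h
  · have h1 : auxCoord γ lam i f n i = γ := by simp [auxCoord, tailCount_last, h]
    rw [h, h1, add_sub_cancel_right, mul_comm]
    congr 2
    refine Finset.prod_congr rfl fun a ha => ?_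
    simp [auxCoord, tailCount_last, h, (Finset.ne_of_mem_erase ha).symm]
  · have h1 : auxCoord γ lam i f n i = 0 := by simp [auxCoord, tailCount_last, h]
    rw [Finset.prod_eq_zero (Finset.mem_erase.2 ⟨Ne.symm h, Finset.mem_univ i⟩)
      (by rw [h1, theta_zero])]
    simp

/-- The indicator function of the configurations in which `i` occurs `ℓ + 1` times and every
other index `ℓ` times. -/
def weightIndicator {N n : ℕ} (ℓ : ℕ) (i : Fin N) (f : Fin (n + 1) → Fin N) : ℂ :=
  if ∀ a, (Finset.univ.filter fun c => f c = a).card = ℓ + if i = a then 1 else 0 then 1 else 0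

theorem weightIndicator_comp_perm {N n : ℕ} (ℓ : ℕ) (i : Fin N) (f : Fin (n + 1) → Fin N)
    (σ : Equiv.Perm (Fin (n + 1))) : weightIndicator ℓ i (f ∘ σ) = weightIndicator ℓ i f := by
  have h (a : Fin N) : (Finset.univ.filter fun c => (f ∘ σ) c = a).card =
      (Finset.univ.filter fun c => f c = a).card :=
    Finset.card_bijective σ σ.bijective (by simp)
  simp only [weightIndicator, h]

theorem weightIndicator_eq_evec {N n : ℕ} (ℓ : ℕ) (f : Fin (n + 1) → Fin N) :
    weightIndicator ℓ (f 0) f = evec N n ℓ (Fin.tail f) := by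
  have h (a : Fin N) : (Finset.univ.filter fun c => f c = a).card =
      (Finset.univ.filter fun c => Fin.tail f c = a).card + if f 0 = a then 1 else 0 := by
    rw [Fin.card_filter_univ_succ]
    split_ifs <;> rfl
  simp only [weightIndicator, evec, h, add_left_inj]

theorem Lop_mulVec_evec {N n : ℕ} (ℓ : ℕ) {τ : ℂ} (hτ : 0 < τ.im) (γ z : ℂ) (lam : Fin N → ℂ)
    (i : Fin N) (hz : ∀ k ≤ n, theta τ (z - k * γ) ≠ 0)
    (hlam : ∀ a b, a ≠ b → ∀ p : ℤ, |p| ≤ n + 2 → theta τ (lam a - lam b + p * γ) ≠ 0)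
    (g : Fin n → Fin N) :
    (Lop N n τ γ z 0 lam).mulVec
        (fun f => (if f 0 = i then (1 : ℂ) else 0) * evec N n ℓ (Fin.tail f)) (Fin.cons i g) =
      theta τ (z - γ * ℓ) / theta τ (z - n * γ) *
        (∏ j ∈ Finset.univ.erase i,
          theta τ (lam i - lam j + ℓ * γ) / theta τ (lam i - lam j)) * evec N n ℓ g := by
  have hprod : ∏ a ∈ Finset.univ.erase i, theta τ (lam i - lam a) ≠ 0 := by
    refine Finset.prod_ne_zero_iff.2 fun a ha => ?_
    simpa using hlam i a (Finset.ne_of_mem_erase ha).symm 0 (by rw [abs_zero]; positivity)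
  have hlast : partialState τ γ z lam i (weightIndicator ℓ i) n =
      (theta τ (z - n * γ) * ∏ a ∈ Finset.univ.erase i, theta τ (lam i - lam a)) •
        fun f : Fin (n + 1) → Fin N =>
          (if f 0 = i then (1 : ℂ) else 0) * evec N n ℓ (Fin.tail f) := by
    funext f
    rw [partialState_last, Pi.smul_apply, smul_eq_mul]
    split_ifs with h
    · rw [← h, weightIndicator_eq_evec, one_mul]
    · rw [zero_mul]
  have key := congrFun (Lop_mulVec_partialState hτ γ z lam i (weightIndicator ℓ i)
    (weightIndicator_comp_perm ℓ i) hz hlam) (Fin.cons i g)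
  have hW : weightIndicator ℓ i (Fin.cons i g : Fin (n + 1) → Fin N) = evec N n ℓ g := by
    simpa using weightIndicator_eq_evec ℓ (Fin.cons i g : Fin (n + 1) → Fin N)
  have hfirst : partialState τ γ z lam i (weightIndicator ℓ i) 0 (Fin.cons i g) =
      evec N n ℓ g * (theta τ (z - γ * ℓ) *
        ∏ a ∈ Finset.univ.erase i, theta τ (lam i - lam a + ℓ * γ)) := by
    rw [partialState, hW, evec]
    split_ifs with hg
    · have hcount (a : Fin N) : tailCount (Fin.cons i g : Fin (n + 1) → Fin N) 0 a = ℓ := by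
        rw [tailCount_zero, Fin.tail_cons, hg]
      rw [thetaState]
      congr 2
      · congr 1
        simp [auxCoord, hcount]
        ring
      · refine Finset.prod_congr rfl fun a ha => ?_
        simp [auxCoord, hcount, (Finset.ne_of_mem_erase ha).symm, mul_comm]
    · simp
  rw [hlast, Matrix.mulVec_smul, Pi.smul_apply, smul_eq_mul, hfirst] at key
  have hzn := hz n le_rfl
  rw [Finset.prod_div_distrib, div_mul_div_comm, div_mul_eq_mul_div,
    eq_div_iff (mul_ne_zero hzn hprod)]
  linear_combination key

/-- The common non-vanishing locus of `θ ∘ φ`, for finitely many nonzero linear forms `φ`, is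
open and dense. -/
theorem isOpen_and_dense_theta_ne_zero {E : Type*} [NormedAddCommGroup E] [NormedSpace ℂ E]
    [CompleteSpace E] {τ : ℂ} (hτ : 0 < τ.im) {s : Set (E →L[ℂ] ℂ)} (hs : s.Finite)
    (h0 : ∀ φ ∈ s, φ ≠ 0) :
    IsOpen (⋂ φ ∈ s, {x | theta τ (φ x) ≠ 0}) ∧ Dense (⋂ φ ∈ s, {x | theta τ (φ x) ≠ 0}) := by
  have hopen (φ : E →L[ℂ] ℂ) : IsOpen {x | theta τ (φ x) ≠ 0} :=
    isOpen_ne.preimage ((differentiable_theta hτ).continuous.comp φ.continuous)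
  refine ⟨hs.isOpen_biInter fun φ _ => hopen φ,
    dense_biInter_of_isOpen (fun φ _ => hopen φ) hs.countable fun φ hφ => ?_⟩
  refine (dense_theta_ne_zero hτ).preimage (φ.isOpenMap ?_)
  refine LinearMap.surjective (f := (φ : E →ₗ[ℂ] ℂ)) fun h => h0 φ hφ ?_
  ext x
  exact LinearMap.congr_fun h x

theorem exists_generic_set (N n : ℕ) {τ : ℂ} (hτ : 0 < τ.im) :
    ∃ U : Set (ℂ × ℂ × (Fin N → ℂ)), IsOpen U ∧ Dense U ∧
      ∀ z γ : ℂ, ∀ lam : Fin N → ℂ, (z, γ, lam) ∈ U →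
        (∀ k ≤ n, theta τ (z - k * γ) ≠ 0) ∧
        ∀ a b, a ≠ b → ∀ p : ℤ, |p| ≤ n + 2 → theta τ (lam a - lam b + p * γ) ≠ 0 := by
  let pz : ℂ × ℂ × (Fin N → ℂ) →L[ℂ] ℂ := ContinuousLinearMap.fst ℂ _ _
  let pg : ℂ × ℂ × (Fin N → ℂ) →L[ℂ] ℂ :=
    (ContinuousLinearMap.fst ℂ _ _).comp (ContinuousLinearMap.snd ℂ _ _)
  let pl (a : Fin N) : ℂ × ℂ × (Fin N → ℂ) →L[ℂ] ℂ :=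
    ((ContinuousLinearMap.proj a).comp (ContinuousLinearMap.snd ℂ _ _)).comp
      (ContinuousLinearMap.snd ℂ _ _)
  let φ (k : Fin (n + 1)) := pz - ((k : ℕ) : ℂ) • pg
  let ψ (q : {q : Fin N × Fin N // q.1 ≠ q.2} × Set.Icc (-(n + 2) : ℤ) (n + 2)) :=
    pl q.1.1.1 - pl q.1.1.2 + ((q.2 : ℤ) : ℂ) • pg
  obtain ⟨hopen, hdense⟩ := isOpen_and_dense_theta_ne_zero hτ
    (s := Set.range φ ∪ Set.range ψ) ((Set.finite_range φ).union (Set.finite_range ψ)) (by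
      rintro _ (⟨k, rfl⟩ | ⟨⟨⟨⟨a, b⟩, hab⟩, p⟩, rfl⟩) h
      · simpa [φ, pz, pg] using congrArg (fun χ => χ (1, 0, 0)) h
      · simpa [ψ, pl, pg, hab.symm] using congrArg (fun χ => χ (0, 0, Pi.single a 1)) h)
  refine ⟨_, hopen, hdense, fun z γ lam h => ?_⟩
  rw [Set.mem_iInter₂] at h
  refine ⟨fun k hk => ?_, fun a b hab p hp => ?_⟩
  · exact h (φ ⟨k, Nat.lt_succ_of_le hk⟩) (.inl ⟨_, rfl⟩)
  · exact h (ψ (⟨(a, b), hab⟩, ⟨p, abs_le.1 hp⟩)) (.inr ⟨_, rfl⟩)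

/-- writing `L(z,λ)(e_i ⊗ e) = ∑_j e_j ⊗ v_j` for the `L`-operator of
`V^{⊗Nℓ}(0)`, one has `v_i = θ(z-γℓ)/θ(z-γNℓ) ∏_{j≠i} θ(λ_i-λ_j+ℓγ)/θ(λ_i-λ_j) · e`;
consequently the transfer matrix of `S^{Nℓ}V(0)` equals `θ(z-γℓ)/θ(z-γNℓ)` times the
Ruijsenaars operator `M`. -/
theorem transfer_symmetric_power_is_Ruijsenaars (N ℓ : ℕ) (hN : 2 ≤ N) (hℓ : 1 ≤ ℓ)
    (τ : ℂ) (hτ : 0 < τ.im) :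
    ∃ U : Set (ℂ × ℂ × (Fin N → ℂ)), IsOpen U ∧ Dense U ∧
      ∀ z γ : ℂ, ∀ lam : Fin N → ℂ, (z, γ, lam) ∈ U →
        (∀ i : Fin N,
          (fun g : Fin (N * ℓ) → Fin N =>
            (Lop N (N * ℓ) τ γ z 0 lam).mulVec
              (fun f => (if f 0 = i then (1 : ℂ) else 0) * evec N (N * ℓ) ℓ (Fin.tail f))
              (Fin.cons i g)) =
          (theta τ (z - γ * (ℓ : ℂ)) / theta τ (z - γ * (N : ℂ) * (ℓ : ℂ)) *
            ∏ j ∈ Finset.univ.filter (fun j : Fin N => j ≠ i),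
              theta τ (lam i - lam j + (ℓ : ℂ) * γ) / theta τ (lam i - lam j)) •
            evec N (N * ℓ) ℓ) ∧
        ∀ f : (Fin N → ℂ) → ℂ,
          (∑ i : Fin N,
            (theta τ (z - γ * (ℓ : ℂ)) / theta τ (z - γ * (N : ℂ) * (ℓ : ℂ)) *
              ∏ j ∈ Finset.univ.filter (fun j : Fin N => j ≠ i),
                theta τ (lam i - lam j + (ℓ : ℂ) * γ) / theta τ (lam i - lam j)) *
              f (fun r => lam r - if r = i then γ else 0)) =
          theta τ (z - γ * (ℓ : ℂ)) / theta τ (z - γ * (N : ℂ) * (ℓ : ℂ)) *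
            ∑ i : Fin N,
              (∏ j ∈ Finset.univ.filter (fun j : Fin N => j ≠ i),
                theta τ (lam i - lam j + (ℓ : ℂ) * γ) / theta τ (lam i - lam j)) *
                f (fun r => lam r - if r = i then γ else 0) := by
  obtain ⟨U, hopen, hdense, hU⟩ := exists_generic_set N (N * ℓ) hτ
  refine ⟨U, hopen, hdense, fun z γ lam h => ⟨fun i => ?_, fun f => ?_⟩⟩
  · obtain ⟨hz, hlam⟩ := hU z γ lam h
    funext g
    rw [Lop_mulVec_evec ℓ hτ γ z lam i hz hlam g, Pi.smul_apply, smul_eq_mul,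
      Finset.filter_ne' Finset.univ i]
    congr 4
    push_cast
    ring
  · simp only [Finset.mul_sum, mul_assoc]

end EllipticQG
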